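/- arXiv:2212.14328 — 3 statements merged into one kernel-verified Lean document; each statement's English description precedes it below -/
import Mathlib

section
/- Let v_1, ..., v_k be an orthonormal family of vectors in the Euclidean space ℝ^N, let H : ℝ^N → ℝ^N be a symmetric (self-adjoint) linear map, and for 1 ≤ i ≤ k set P_i := I − v_i v_iᵀ − 2 ∑_{j=1}^{i−1} v_j v_jᵀ. Then for all 1 ≤ j < i ≤ k one has ⟨v_j, P_i H v_i⟩ + ⟨v_i, P_j H v_j⟩ = 0. -/
open scoped RealInnerProductSpace

/-- For an orthonormal family `v_1, …, v_k` in `ℝ^N`, a symmetric linear map `H`, and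
`P_i = I - v_i v_iᵀ - 2 ∑_{j<i} v_j v_jᵀ`, for all `j < i` one has
`⟨v_j, P_i H v_i⟩ + ⟨v_i, P_j H v_j⟩ = 0`: the mutual orthogonality of the directions
is infinitesimally preserved along saddle dynamics. -/
theorem saddle_direction_orthogonality_preserved {N k : ℕ}
    (v : Fin k → EuclideanSpace ℝ (Fin N)) (hv : Orthonormal ℝ v)
    (H : EuclideanSpace ℝ (Fin N) →ₗ[ℝ] EuclideanSpace ℝ (Fin N))
    (hH : ∀ x y, ⟪H x, y⟫ = ⟪x, H y⟫) :
    ∀ i j : Fin k, j < i →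
      ⟪v j, H (v i) - ⟪v i, H (v i)⟫ • v i
          - (2 : ℝ) • ∑ m ∈ Finset.Iio i, ⟪v m, H (v i)⟫ • v m⟫
        + ⟪v i, H (v j) - ⟪v j, H (v j)⟫ • v j
            - (2 : ℝ) • ∑ m ∈ Finset.Iio j, ⟪v m, H (v j)⟫ • v m⟫ = 0 := by
  intro i j hji
  have hsymm : ⟪v i, H (v j)⟫ = ⟪v j, H (v i)⟫ := by
    rw [← hH, real_inner_comm]
  have hsum (a b : Fin k) (x : EuclideanSpace ℝ (Fin N)) :
      ⟪v a, ∑ m ∈ Finset.Iio b, ⟪v m, x⟫ • v m⟫ = if a < b then ⟪v a, x⟫ else 0 := by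
    simp [inner_sum, real_inner_smul_right, orthonormal_iff_ite.mp hv]
  simp only [inner_sub_right, real_inner_smul_right, hsum, hv.2 hji.ne, hv.2 hji.ne',
    if_pos hji, if_neg hji.not_gt, hsymm]
  ring
end

section
/- Let v_1, ..., v_k be an orthonormal family of vectors in the Euclidean space ℝ^N, let H : ℝ^N → ℝ^N be a symmetric (self-adjoint) linear map, and for 1 ≤ i ≤ k set P_i := I − v_i v_iᵀ − 2 ∑_{j=1}^{i−1} v_j v_jᵀ. If P_i H v_i = 0 for every 1 ≤ i ≤ k, then each v_i is an eigenvector of H with eigenvalue ⟨v_i, H v_i⟩, i.e., H v_i = ⟨v_i, H v_i⟩ v_i for all 1 ≤ i ≤ k. -/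
open scoped RealInnerProductSpace

/-- For an orthonormal family `v_1, …, v_k` in `ℝ^N` and a symmetric linear map `H`,
if `P_i H v_i = 0` for every `i`, where `P_i = I - v_i v_iᵀ - 2 ∑_{j<i} v_j v_jᵀ`,
then each `v_i` is an eigenvector of `H` with eigenvalue `⟨v_i, H v_i⟩`. -/
theorem saddle_direction_stationary_eigenvectors {N k : ℕ}
    (v : Fin k → EuclideanSpace ℝ (Fin N)) (hv : Orthonormal ℝ v)
    (H : EuclideanSpace ℝ (Fin N) →ₗ[ℝ] EuclideanSpace ℝ (Fin N))
    (hH : ∀ x y, ⟪H x, y⟫ = ⟪x, H y⟫)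
    (hstat : ∀ i : Fin k,
      H (v i) - ⟪v i, H (v i)⟫ • v i
        - (2 : ℝ) • ∑ j ∈ Finset.Iio i, ⟪v j, H (v i)⟫ • v j = 0) :
    ∀ i : Fin k, H (v i) = ⟪v i, H (v i)⟫ • v i := by
  intro i
  have coeff_eq_zero : ∀ l ∈ Finset.Iio i, ⟪v l, H (v i)⟫ = 0 := by
    intro l hl
    have hli : ⟪v l, v i⟫ = 0 := hv.2 (Finset.mem_Iio.mp hl).ne
    have h := congrArg (fun x => ⟪v l, x⟫) (hstat i)
    simp only [inner_sub_right, real_inner_smul_right, inner_zero_right, hli,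
      hv.inner_right_sum (fun j => ⟪v j, H (v i)⟫) hl] at h
    linarith
  have h := hstat i
  rwa [Finset.sum_eq_zero fun j hj => by rw [coeff_eq_zero j hj, zero_smul], smul_zero,
    sub_zero, sub_eq_zero] at h
end

section
/- Let F : ℝ^N → ℝ^N be three times continuously differentiable on the open ball B(x, r), suppose the third derivative satisfies ‖D³F(y)‖ ≤ M for all y ∈ B(x, r), and let v ∈ ℝ^N with ‖v‖ = 1. Then for every 0 < l < r one has ‖(F(x + l v) − F(x − l v)) / (2 l) − DF(x) v‖ ≤ (M/6) l². -/
/-- The derivative along the line `t ↦ x + t • v` of the `n`-th iterated derivative of `f`,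
evaluated on the constant tuple `v`, is the `(n + 1)`-st iterated derivative. -/
theorem ContDiffOn.hasDerivAt_iteratedFDerivWithin_line {E G : Type*}
    [NormedAddCommGroup E] [NormedSpace ℝ E] [NormedAddCommGroup G] [NormedSpace ℝ G]
    {f : E → G} {s : Set E} {m : WithTop ℕ∞} {n : ℕ} (hf : ContDiffOn ℝ m f s) (hs : IsOpen s)
    (hn : (n : WithTop ℕ∞) < m) (x v : E) {t : ℝ} (ht : x + t • v ∈ s) :
    HasDerivAt (fun u : ℝ => iteratedFDerivWithin ℝ n f s (x + u • v) (fun _ => v))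
      (iteratedFDerivWithin ℝ (n + 1) f s (x + t • v) (fun _ => v)) t := by
  have hd : HasFDerivAt (iteratedFDerivWithin ℝ n f s)
      (fderivWithin ℝ (iteratedFDerivWithin ℝ n f s) s (x + t • v)) (x + t • v) :=
    ((hf.differentiableOn_iteratedFDerivWithin hn hs.uniqueDiffOn) _ ht).hasFDerivWithinAt
      |>.hasFDerivAt (hs.mem_nhds ht)
  have hline : HasDerivAt (fun u : ℝ => x + u • v) v t := by
    simpa using ((hasDerivAt_id t).smul_const v).const_add x
  have happ := (ContinuousMultilinearMap.apply ℝ (fun _ : Fin n => E) G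
    (fun _ => v)).hasFDerivAt.comp_hasDerivAt t (hd.comp_hasDerivAt t hline)
  rw [iteratedFDerivWithin_succ_apply_left]
  exact happ

/-- If `f 0 = 0` and `‖f' t‖ ≤ c * t ^ n` on `[0, l]`, then
`‖f t‖ ≤ c / (n + 1) * t ^ (n + 1)` on `[0, l]`. -/
theorem norm_le_mul_pow_succ_of_norm_deriv_le {G : Type*}
    [NormedAddCommGroup G] [NormedSpace ℝ G] {f f' : ℝ → G} {c l : ℝ} {n : ℕ}
    (hf : ∀ t ∈ Set.Icc 0 l, HasDerivAt f (f' t) t) (h0 : f 0 = 0)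
    (hbound : ∀ t ∈ Set.Icc 0 l, ‖f' t‖ ≤ c * t ^ n) :
    ∀ t ∈ Set.Icc 0 l, ‖f t‖ ≤ c / (n + 1) * t ^ (n + 1) := by
  intro t ht
  refine image_norm_le_of_norm_deriv_right_le_deriv_boundary
    (B := fun t => c / (n + 1) * t ^ (n + 1)) (B' := fun t => c * t ^ n)
    (fun u hu => (hf u hu).continuousAt.continuousWithinAt)
    (fun u hu => (hf u (Set.Ico_subset_Icc_self hu)).hasDerivWithinAt)
    (by simp [h0]) (fun u => ?_)
    (fun u hu => hbound u (Set.Ico_subset_Icc_self hu)) ht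
  have hpow := (hasDerivAt_pow (n + 1) u).const_mul (c / (n + 1))
  rwa [Nat.add_sub_cancel, Nat.cast_add_one, ← mul_assoc,
    div_mul_cancel₀ c n.cast_add_one_ne_zero] at hpow

/-- Second-order accuracy of the dimer approximation: if `F` is three times
continuously differentiable on the open ball `B(x, r)` with `‖D³F‖ ≤ M` there,
and `‖v‖ = 1`, then for every `0 < l < r`,
`‖(F(x + l v) - F(x - l v)) / (2 l) - DF(x) v‖ ≤ (M/6) l²`. -/
theorem dimer_difference_second_order {N : ℕ}
    (F : EuclideanSpace ℝ (Fin N) → EuclideanSpace ℝ (Fin N))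
    (x v : EuclideanSpace ℝ (Fin N)) (r M : ℝ) (hr : 0 < r)
    (hF : ContDiffOn ℝ 3 F (Metric.ball x r))
    (hM : ∀ y ∈ Metric.ball x r, ‖iteratedFDerivWithin ℝ 3 F (Metric.ball x r) y‖ ≤ M)
    (hv : ‖v‖ = 1) :
    ∀ l : ℝ, 0 < l → l < r →
      ‖(2 * l)⁻¹ • (F (x + l • v) - F (x - l • v)) - fderiv ℝ F x v‖ ≤ M / 6 * l ^ 2 := by
  intro l hl hlr
  set φ : ℕ → ℝ → EuclideanSpace ℝ (Fin N) := fun k t =>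
    iteratedFDerivWithin ℝ k F (Metric.ball x r) (x + t • v) (fun _ => v) with hφ
  have hmem : ∀ t : ℝ, |t| ≤ l → x + t • v ∈ Metric.ball x r := fun t ht => by
    simpa [norm_smul, hv] using ht.trans_lt hlr
  have hpos : ∀ t ∈ Set.Icc 0 l, |t| ≤ l := fun t ht => by
    rw [abs_of_nonneg ht.1]
    exact ht.2
  have hneg : ∀ t ∈ Set.Icc 0 l, |-t| ≤ l := fun t ht => by
    rw [abs_neg]
    exact hpos t ht
  have hderiv : ∀ k < 3, ∀ t : ℝ, |t| ≤ l → HasDerivAt (φ k) (φ (k + 1) t) t :=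
    fun k hk t ht => hF.hasDerivAt_iteratedFDerivWithin_line Metric.isOpen_ball
      (by exact_mod_cast hk) x v (hmem t ht)
  have hderiv_neg : ∀ k < 3, ∀ t : ℝ, |-t| ≤ l →
      HasDerivAt (fun u => φ k (-u)) (-φ (k + 1) (-t)) t := fun k hk t ht => by
    have := (hderiv k hk (-t) ht).scomp t (hasDerivAt_neg t)
    rwa [neg_one_smul] at this
  have hφ3 : ∀ t : ℝ, |t| ≤ l → ‖φ 3 t‖ ≤ M := fun t ht => by
    refine (ContinuousMultilinearMap.le_opNorm _ _).trans ?_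
    simpa [hv] using hM _ (hmem t ht)
  have hsecond := norm_le_mul_pow_succ_of_norm_deriv_le (c := 2 * M) (l := l) (n := 0)
    (f := fun t => φ 2 t - φ 2 (-t)) (f' := fun t => φ 3 t - -φ 3 (-t))
    (fun t ht => (hderiv 2 (by norm_num) t (hpos t ht)).sub
      (hderiv_neg 2 (by norm_num) t (hneg t ht)))
    (by simp)
    (fun t ht => by
      have := norm_sub_le (φ 3 t) (-φ 3 (-t))
      rw [norm_neg] at this
      linarith [hφ3 t (hpos t ht), hφ3 (-t) (hneg t ht)])
  have hfirst := norm_le_mul_pow_succ_of_norm_deriv_le (l := l)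
    (f := fun t => φ 1 t + φ 1 (-t) - (2 : ℝ) • φ 1 0) (f' := fun t => φ 2 t - φ 2 (-t))
    (fun t ht => by
      simpa [sub_eq_add_neg] using ((hderiv 1 (by norm_num) t (hpos t ht)).add
        (hderiv_neg 1 (by norm_num) t (hneg t ht))).sub_const ((2 : ℝ) • φ 1 0))
    (by simp [two_smul]) hsecond
  have hzeroth := norm_le_mul_pow_succ_of_norm_deriv_le (l := l)
    (f := fun t => φ 0 t - φ 0 (-t) - t • (2 : ℝ) • φ 1 0)
    (f' := fun t => φ 1 t + φ 1 (-t) - (2 : ℝ) • φ 1 0)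
    (fun t ht => by
      have := ((hderiv 0 (by norm_num) t (hpos t ht)).sub
        (hderiv_neg 0 (by norm_num) t (hneg t ht))).sub
        ((hasDerivAt_id t).smul_const ((2 : ℝ) • φ 1 0))
      rwa [sub_neg_eq_add, one_smul] at this)
    (by simp) hfirst l ⟨hl.le, le_rfl⟩
  have hφ0 : ∀ t, φ 0 t = F (x + t • v) := fun t => by simp [hφ]
  have hφ1 : φ 1 0 = fderiv ℝ F x v := by
    have hx : x ∈ Metric.ball x r := Metric.mem_ball_self hr
    simp [hφ, iteratedFDerivWithin_one_apply (Metric.isOpen_ball.uniqueDiffWithinAt hx),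
      fderivWithin_of_isOpen Metric.isOpen_ball hx]
  have hrewrite : (2 * l)⁻¹ • (F (x + l • v) - F (x - l • v)) - fderiv ℝ F x v =
      (2 * l)⁻¹ • (φ 0 l - φ 0 (-l) - l • (2 : ℝ) • φ 1 0) := by
    rw [hφ0, hφ0, hφ1, smul_sub _ _ (l • _), smul_smul l, smul_smul, mul_comm l 2,
      inv_mul_cancel₀ (by positivity), one_smul, neg_smul, ← sub_eq_add_neg]
  rw [hrewrite, norm_smul, norm_inv, Real.norm_of_nonneg (by positivity),
    inv_mul_le_iff₀ (by positivity)]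
  refine hzeroth.trans_eq ?_
  push_cast
  ring
end
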